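/- arXiv:math/0302276 — 2 statements merged into one kernel-verified Lean document; each statement's English description precedes it below -/
import Mathlib

section
/- Let F be a field that is an algebra over ℝ. If d ∈ D₂(F), then 2·d ∈ D₂(F). -/
/-- `φ₂((x₁,x₂),(y₁,y₂)) = (x₁−y₁)² + (x₂−y₂)²` on `F²`. -/
def phi2 (F : Type*) [Field F] (x y : Fin 2 → F) : F := (x 0 - y 0) ^ 2 + (x 1 - y 1) ^ 2

/-- `D₂(F)`: the set of all real `d > 0` such that for all `x, y ∈ ℝ²` with
`|x−y| = d` there is a finite set `S` with `{x,y} ⊆ S ⊆ ℝ²` such that every map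
`f : S → F²` preserving unit distance satisfies `φ₂(f(x),f(y)) = d²`. -/
def D2 (F : Type*) [Field F] [Algebra ℝ F] : Set ℝ :=
  {d | 0 < d ∧ ∀ x y : EuclideanSpace ℝ (Fin 2), dist x y = d →
    ∃ S : Set (EuclideanSpace ℝ (Fin 2)), S.Finite ∧ x ∈ S ∧ y ∈ S ∧
      ∀ f : EuclideanSpace ℝ (Fin 2) → (Fin 2 → F),
        (∀ u ∈ S, ∀ v ∈ S, dist u v = 1 → phi2 F (f u) (f v) = 1) →
        phi2 F (f x) (f y) = algebraMap ℝ F (d ^ 2)}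

/-- `f` preserves unit distances between points of `S`. -/
def UnitPreservingOn (F : Type*) [Field F] (f : EuclideanSpace ℝ (Fin 2) → (Fin 2 → F))
    (S : Set (EuclideanSpace ℝ (Fin 2))) : Prop :=
  ∀ u ∈ S, ∀ v ∈ S, dist u v = 1 → phi2 F (f u) (f v) = 1

/-- For `d ∈ D₂(F)`, all distances `d` inside a finite set are preserved simultaneously by the
unit-distance preserving maps of some larger finite set. -/
theorem exists_finite_superset_preserving {F : Type*} [Field F] [Algebra ℝ F] {d : ℝ}
    (hd : d ∈ D2 F) {P : Set (EuclideanSpace ℝ (Fin 2))} (hP : P.Finite) :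
    ∃ S : Set (EuclideanSpace ℝ (Fin 2)), S.Finite ∧ P ⊆ S ∧
      ∀ f, UnitPreservingOn F f S → ∀ u ∈ P, ∀ v ∈ P, dist u v = d →
        phi2 F (f u) (f v) = algebraMap ℝ F (d ^ 2) := by
  have h : ∀ p : EuclideanSpace ℝ (Fin 2) × EuclideanSpace ℝ (Fin 2),
      ∃ T : Set (EuclideanSpace ℝ (Fin 2)), T.Finite ∧
        ∀ f, UnitPreservingOn F f T → dist p.1 p.2 = d →
          phi2 F (f p.1) (f p.2) = algebraMap ℝ F (d ^ 2) := by
    intro p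
    by_cases hp : dist p.1 p.2 = d
    · obtain ⟨T, hT, -, -, hf⟩ := hd.2 p.1 p.2 hp
      exact ⟨T, hT, fun f h _ => hf f h⟩
    · exact ⟨∅, Set.finite_empty, fun f _ h => absurd h hp⟩
  choose T hT hf using h
  refine ⟨P ∪ ⋃ p ∈ P ×ˢ P, T p, hP.union ((hP.prod hP).biUnion fun p _ => hT p),
    Set.subset_union_left, fun f h u hu v hv huv => hf (u, v) f ?_ huv⟩
  have hsub : T (u, v) ⊆ P ∪ ⋃ p ∈ P ×ˢ P, T p :=
    (Set.subset_biUnion_of_mem (u := T) (Set.mk_mem_prod hu hv)).trans Set.subset_union_right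
  exact fun a ha b hb => h a (hsub ha) b (hsub hb)

/-- Two apexes of equilateral triangles on the base `a b` are equal or symmetric with respect to
the midpoint of `a` and `b`. -/
theorem eq_or_eq_add_sub_of_phi2_eq {F : Type*} [Field F] [CharZero F] {D : F} (hD : D ≠ 0)
    {p q a b : Fin 2 → F} (hab : phi2 F a b = D) (hpa : phi2 F p a = D) (hpb : phi2 F p b = D)
    (hqa : phi2 F q a = D) (hqb : phi2 F q b = D) :
    q = p ∨ q = a + b - p := by
  simp only [phi2] at *
  have h1 : (p 0 - q 0) * (a 0 - b 0) + (p 1 - q 1) * (a 1 - b 1) = 0 := by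
    have : (2 : F) ≠ 0 := two_ne_zero
    apply mul_left_cancel₀ this
    linear_combination hpb - hpa + hqa - hqb
  have h2 : (p 0 + q 0 - a 0 - b 0) * (a 0 - b 0) + (p 1 + q 1 - a 1 - b 1) * (a 1 - b 1) = 0 := by
    have : (2 : F) ≠ 0 := two_ne_zero
    apply mul_left_cancel₀ this
    linear_combination hpb - hpa - hqa + hqb
  have h3 : (p 0 - q 0) * (p 0 + q 0 - a 0 - b 0) + (p 1 - q 1) * (p 1 + q 1 - a 1 - b 1) = 0 := by
    have : (2 : F) ≠ 0 := two_ne_zero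
    apply mul_left_cancel₀ this
    linear_combination hpb + hpa - hqa - hqb
  have h4 : ((p 0 - q 0) * (a 1 - b 1) - (p 1 - q 1) * (a 0 - b 0)) *
      ((p 0 + q 0 - a 0 - b 0) * (a 1 - b 1) - (p 1 + q 1 - a 1 - b 1) * (a 0 - b 0)) = 0 := by
    linear_combination ((a 0 - b 0) ^ 2 + (a 1 - b 1) ^ 2) * h3 -
      ((p 0 - q 0) * (a 0 - b 0) + (p 1 - q 1) * (a 1 - b 1)) * h2
  rcases mul_eq_zero.1 h4 with h | h
  · left
    funext i
    apply mul_left_cancel₀ hD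
    rw [← hab]
    fin_cases i
    · simp only [Fin.zero_eta]
      linear_combination -(a 0 - b 0) * h1 - (a 1 - b 1) * h
    · simp only [Fin.mk_one]
      linear_combination -(a 1 - b 1) * h1 + (a 0 - b 0) * h
  · right
    funext i
    apply mul_left_cancel₀ hD
    rw [← hab]
    fin_cases i
    · simp only [Fin.zero_eta, Pi.add_apply, Pi.sub_apply]
      linear_combination (a 0 - b 0) * h2 + (a 1 - b 1) * h
    · simp only [Fin.mk_one, Pi.add_apply, Pi.sub_apply]
      linear_combination (a 1 - b 1) * h2 - (a 0 - b 0) * h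

theorem phi2_self {F : Type*} [Field F] (p : Fin 2 → F) : phi2 F p p = 0 := by
  simp [phi2]

/-- The long diagonal of a rhombus made of two equilateral triangles, unless degenerate. -/
theorem eq_or_phi2_eq_three_mul {F : Type*} [Field F] [CharZero F] {D : F} (hD : D ≠ 0)
    {p q a b : Fin 2 → F} (hab : phi2 F a b = D) (hpa : phi2 F p a = D) (hpb : phi2 F p b = D)
    (hqa : phi2 F q a = D) (hqb : phi2 F q b = D) :
    q = p ∨ phi2 F p q = 3 * D := by
  refine (eq_or_eq_add_sub_of_phi2_eq hD hab hpa hpb hqa hqb).imp_right ?_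
  rintro rfl
  simp only [phi2, Pi.add_apply, Pi.sub_apply] at *
  linear_combination 2 * hpa + 2 * hpb - hab

/-- The point with coordinates `(α, β)` in the frame with origin `x` whose first axis vector is
`y - x` and whose second one is its rotation by a right angle. -/
noncomputable def framePoint (x y : EuclideanSpace ℝ (Fin 2)) (α β : ℝ) :
    EuclideanSpace ℝ (Fin 2) :=
  !₂[x 0 + α * (y 0 - x 0) - β * (y 1 - x 1), x 1 + α * (y 1 - x 1) + β * (y 0 - x 0)]

theorem framePoint_zero (x y : EuclideanSpace ℝ (Fin 2)) : framePoint x y 0 0 = x := by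
  ext i; fin_cases i <;> simp [framePoint]

theorem framePoint_one (x y : EuclideanSpace ℝ (Fin 2)) : framePoint x y 1 0 = y := by
  ext i; fin_cases i <;> simp [framePoint]

theorem dist_framePoint {x y : EuclideanSpace ℝ (Fin 2)} {α β γ δ d : ℝ} (hd : 0 ≤ d)
    (h : ((α - γ) ^ 2 + (β - δ) ^ 2) * dist x y ^ 2 = d ^ 2) :
    dist (framePoint x y α β) (framePoint x y γ δ) = d := by
  rw [← sq_eq_sq₀ dist_nonneg hd, ← h]
  simp only [EuclideanSpace.dist_sq_eq, Fin.sum_univ_two, Real.dist_eq, sq_abs, framePoint,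
    Matrix.cons_val_zero, Matrix.cons_val_one]
  ring

theorem dist_left_framePoint {x y : EuclideanSpace ℝ (Fin 2)} {α β d : ℝ} (hd : 0 ≤ d)
    (h : (α ^ 2 + β ^ 2) * dist x y ^ 2 = d ^ 2) : dist x (framePoint x y α β) = d := by
  have := dist_framePoint (x := x) (y := y) (α := 0) (β := 0) (γ := α) (δ := β) hd
    (by rw [← h]; ring)
  rwa [framePoint_zero] at this

theorem dist_right_framePoint {x y : EuclideanSpace ℝ (Fin 2)} {α β d : ℝ} (hd : 0 ≤ d)
    (h : ((α - 1) ^ 2 + β ^ 2) * dist x y ^ 2 = d ^ 2) : dist y (framePoint x y α β) = d := by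
  have := dist_framePoint (x := x) (y := y) (α := 1) (β := 0) (γ := α) (δ := β) hd
    (by rw [← h]; ring)
  rwa [framePoint_one] at this

theorem exists_rhombus {x y : EuclideanSpace ℝ (Fin 2)} {d : ℝ} (hd : 0 ≤ d)
    (h : dist x y = √3 * d) : ∃ a b : EuclideanSpace ℝ (Fin 2),
      dist a b = d ∧ dist x a = d ∧ dist x b = d ∧ dist y a = d ∧ dist y b = d := by
  have h3 : √3 ^ 2 = 3 := Real.sq_sqrt (by norm_num)
  have h2 : dist x y ^ 2 = 3 * d ^ 2 := by rw [h, mul_pow, h3]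
  refine ⟨framePoint x y (1 / 2) (√3 / 6), framePoint x y (1 / 2) (-√3 / 6),
    dist_framePoint hd ?_, dist_left_framePoint hd ?_, dist_left_framePoint hd ?_,
    dist_right_framePoint hd ?_, dist_right_framePoint hd ?_⟩ <;> rw [h2]
  · linear_combination d ^ 2 / 3 * h3
  all_goals linear_combination d ^ 2 / 12 * h3

theorem algebraMap_sq_ne_zero {F : Type*} [Field F] [Algebra ℝ F] {d : ℝ} (hd : 0 < d) :
    algebraMap ℝ F (d ^ 2) ≠ 0 :=
  (map_ne_zero _).2 (by positivity)

theorem sqrt_three_mul_mem_D2 {F : Type*} [Field F] [Algebra ℝ F] {d : ℝ} (hd : d ∈ D2 F) :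
    √3 * d ∈ D2 F := by
  have : CharZero F := charZero_of_injective_algebraMap (algebraMap ℝ F).injective
  have hd0 : 0 < d := hd.1
  refine ⟨by positivity, fun x y hxy => ?_⟩
  have h3 : √3 ^ 2 = 3 := Real.sq_sqrt (by norm_num)
  have h11 : √11 ^ 2 = 11 := Real.sq_sqrt (by norm_num)
  have hxy2 : dist x y ^ 2 = 3 * d ^ 2 := by rw [hxy, mul_pow, h3]
  obtain ⟨z, hxz, hyz⟩ : ∃ z, dist x z = √3 * d ∧ dist y z = d := by
    refine ⟨framePoint x y (5 / 6) (√11 / 6), dist_left_framePoint (by positivity) ?_,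
      dist_right_framePoint hd0.le ?_⟩ <;> rw [hxy2]
    · linear_combination d ^ 2 / 12 * h11 - d ^ 2 * h3
    · linear_combination d ^ 2 / 12 * h11
  obtain ⟨a, b, hab, hxa, hxb, hya, hyb⟩ := exists_rhombus hd0.le hxy
  obtain ⟨a', b', hab', hxa', hxb', hza', hzb'⟩ := exists_rhombus hd0.le hxz
  obtain ⟨S, hS, hPS, hf⟩ := exists_finite_superset_preserving hd
    (P := {x, y, z, a, b, a', b'}) (Set.toFinite _)
  refine ⟨S, hS, hPS (by simp), hPS (by simp), fun f hfS => ?_⟩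
  have key := hf f hfS
  have hD : algebraMap ℝ F (d ^ 2) ≠ 0 := algebraMap_sq_ne_zero hd0
  have hyz' := key y (by simp) z (by simp) hyz
  rw [mul_pow, h3, map_mul, map_ofNat]
  refine (eq_or_phi2_eq_three_mul hD (key a (by simp) b (by simp) hab)
    (key x (by simp) a (by simp) hxa) (key x (by simp) b (by simp) hxb)
    (key y (by simp) a (by simp) hya) (key y (by simp) b (by simp) hyb)).resolve_left fun hyx => ?_
  rw [hyx] at hyz'
  rcases eq_or_phi2_eq_three_mul hD (key a' (by simp) b' (by simp) hab')
    (key x (by simp) a' (by simp) hxa') (key x (by simp) b' (by simp) hxb')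
    (key z (by simp) a' (by simp) hza') (key z (by simp) b' (by simp) hzb') with h | h
  · rw [h, phi2_self] at hyz'
    exact hD hyz'.symm
  · rw [hyz'] at h
    have h2 : (2 : F) * algebraMap ℝ F (d ^ 2) = 0 := by linear_combination -h
    exact (mul_ne_zero two_ne_zero hD) h2

/-- If `d ∈ D₂(F)` then `2 · d ∈ D₂(F)`. -/
theorem stmt9 (F : Type*) [Field F] [Algebra ℝ F] (d : ℝ) (hd : d ∈ D2 F) :
    2 * d ∈ D2 F := by
  have : CharZero F := charZero_of_injective_algebraMap (algebraMap ℝ F).injective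
  have hd0 : 0 < d := hd.1
  refine ⟨by positivity, fun x y hxy => ?_⟩
  have h3 : √3 ^ 2 = 3 := Real.sq_sqrt (by norm_num)
  have hxy2 : dist x y ^ 2 = 4 * d ^ 2 := by rw [hxy]; ring
  obtain ⟨o, a, b, hxo, hxa, hoa, hab, hob, hya, hyb, hyo, hxb⟩ :
      ∃ o a b, dist x o = d ∧ dist x a = d ∧ dist o a = d ∧ dist a b = d ∧ dist o b = d ∧
        dist y a = √3 * d ∧ dist y b = d ∧ dist y o = d ∧ dist x b = √3 * d := by
    have hd3 : 0 ≤ √3 * d := by positivity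
    refine ⟨framePoint x y (1 / 2) 0, framePoint x y (1 / 4) (√3 / 4),
      framePoint x y (3 / 4) (√3 / 4), dist_left_framePoint hd0.le ?_,
      dist_left_framePoint hd0.le ?_, dist_framePoint hd0.le ?_, dist_framePoint hd0.le ?_,
      dist_framePoint hd0.le ?_, dist_right_framePoint hd3 ?_, dist_right_framePoint hd0.le ?_,
      dist_right_framePoint hd0.le ?_, dist_left_framePoint hd3 ?_⟩ <;>
      rw [hxy2] <;> ring_nf <;> rw [h3] <;> ring
  obtain ⟨S, hS, hPS, hf⟩ := exists_finite_superset_preserving hd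
    (P := {x, y, o, a, b}) (Set.toFinite _)
  obtain ⟨T, hT, hPT, hg⟩ := exists_finite_superset_preserving (sqrt_three_mul_mem_D2 hd)
    (P := {x, y, o, a, b}) (Set.toFinite _)
  refine ⟨S ∪ T, hS.union hT, Or.inl (hPS (by simp)), Or.inl (hPS (by simp)), fun f hfST => ?_⟩
  have key := hf f fun u hu v hv => hfST u (Or.inl hu) v (Or.inl hv)
  have key3 := hg f fun u hu v hv => hfST u (Or.inr hu) v (Or.inr hv)
  have hD : algebraMap ℝ F (d ^ 2) ≠ 0 := algebraMap_sq_ne_zero hd0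
  have hD3 : algebraMap ℝ F ((√3 * d) ^ 2) ≠ 0 := algebraMap_sq_ne_zero (by positivity)
  have hb : f b = f o + f a - f x := by
    refine (eq_or_eq_add_sub_of_phi2_eq hD (key o (by simp) a (by simp) hoa)
      (key x (by simp) o (by simp) hxo) (key x (by simp) a (by simp) hxa)
      (key b (by simp) o (by simp) (dist_comm o b ▸ hob))
      (key b (by simp) a (by simp) (dist_comm a b ▸ hab))).resolve_left fun h => ?_
    have := key3 x (by simp) b (by simp) hxb
    rw [h, phi2_self] at this
    exact hD3 this.symm
  have hy : f y = f o + f b - f a := by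
    refine (eq_or_eq_add_sub_of_phi2_eq hD (key o (by simp) b (by simp) hob)
      (key a (by simp) o (by simp) (dist_comm o a ▸ hoa)) (key a (by simp) b (by simp) hab)
      (key y (by simp) o (by simp) hyo) (key y (by simp) b (by simp) hyb)).resolve_left fun h => ?_
    have := key3 y (by simp) a (by simp) hya
    rw [h, phi2_self] at this
    exact hD3 this.symm
  have hxo' := key x (by simp) o (by simp) hxo
  rw [mul_pow, map_mul, ← hxo', hy, hb, map_pow, map_ofNat]
  simp only [phi2, Pi.add_apply, Pi.sub_apply]
  ring
end

section
/- Let F be a field that is an algebra over ℝ. If d ∈ D₂(F), then for every integer k ≥ 2 the distance d/k belongs to D₂(F). -/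
open Filter

/-- The filter of properties of a map `f : ℝ² → F²` that hold as soon as `f` preserves unit
distance on some finite set depending only on the property. -/
def unitFilter (F : Type*) [Field F] : Filter (EuclideanSpace ℝ (Fin 2) → (Fin 2 → F)) where
  sets := {R | ∃ S : Set (EuclideanSpace ℝ (Fin 2)), S.Finite ∧
    ∀ f : EuclideanSpace ℝ (Fin 2) → (Fin 2 → F),
      (∀ u ∈ S, ∀ v ∈ S, dist u v = 1 → phi2 F (f u) (f v) = 1) → f ∈ R}
  univ_sets := ⟨∅, Set.finite_empty, fun _ _ => trivial⟩
  sets_of_superset := by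
    rintro R R' ⟨S, hS, h⟩ hR
    exact ⟨S, hS, fun f hf => hR (h f hf)⟩
  inter_sets := by
    rintro R R' ⟨S, hS, h⟩ ⟨S', hS', h'⟩
    exact ⟨S ∪ S', hS.union hS', fun f hf =>
      ⟨h f fun u hu v hv => hf u (.inl hu) v (.inl hv),
        h' f fun u hu v hv => hf u (.inr hu) v (.inr hv)⟩⟩

lemma mem_D2_iff (F : Type*) [Field F] [Algebra ℝ F] (d : ℝ) :
    d ∈ D2 F ↔ 0 < d ∧ ∀ x y : EuclideanSpace ℝ (Fin 2), dist x y = d →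
      ∀ᶠ f in unitFilter F, phi2 F (f x) (f y) = algebraMap ℝ F (d ^ 2) := by
  refine and_congr_right fun _ => forall₃_congr fun x y _ => ⟨?_, ?_⟩
  · rintro ⟨S, hS, -, -, h⟩
    exact ⟨S, hS, h⟩
  · rintro ⟨S, hS, h⟩
    exact ⟨insert x (insert y S), (hS.insert y).insert x, by simp, by simp, fun f hf =>
      h f fun u hu v hv => hf u (by simp [hu]) v (by simp [hv])⟩

lemma dist_eq_iff_sq_add_sq {d : ℝ} (hd : 0 < d) (x y : EuclideanSpace ℝ (Fin 2)) :
    dist x y = d ↔ (x 0 - y 0) ^ 2 + (x 1 - y 1) ^ 2 = d ^ 2 := by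
  rw [EuclideanSpace.dist_eq, Real.sqrt_eq_iff_eq_sq (by positivity) hd.le]
  simp [Fin.sum_univ_two, Real.dist_eq, sq_abs]

/-- In `F²`, two points equidistant from two points `p`, `q`, all at mutual nonzero squared
distance `c`, are equal or opposite vertices of a parallelogram. -/
lemma eq_or_eq_of_phi2_eq {F : Type*} [Field F] [CharZero F] {c : F} (hc : c ≠ 0)
    {a p q b : Fin 2 → F} (hpq : phi2 F p q = c) (hap : phi2 F a p = c) (haq : phi2 F a q = c)
    (hbp : phi2 F b p = c) (hbq : phi2 F b q = c) : b = a ∨ b = p + q - a := by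
  simp only [phi2] at *
  have h2 : (2 : F) ≠ 0 := two_ne_zero
  have h1 : (a 0 - b 0) * (p 0 - q 0) + (a 1 - b 1) * (p 1 - q 1) = 0 := by
    apply mul_left_cancel₀ h2; linear_combination haq - hap + hbp - hbq
  have key : ((a 1 - b 1) * (p 0 - q 0) - (a 0 - b 0) * (p 1 - q 1)) *
      ((a 1 + b 1 - p 1 - q 1) * (p 0 - q 0) - (a 0 + b 0 - p 0 - q 0) * (p 1 - q 1)) = 0 := by
    have h3 : (a 0 - b 0) * (a 0 + b 0 - p 0 - q 0) +
        (a 1 - b 1) * (a 1 + b 1 - p 1 - q 1) = 0 := by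
      apply mul_left_cancel₀ h2; linear_combination haq + hap - hbp - hbq
    linear_combination ((p 0 - q 0) ^ 2 + (p 1 - q 1) ^ 2) * h3 -
      ((a 0 + b 0 - p 0 - q 0) * (p 0 - q 0) + (a 1 + b 1 - p 1 - q 1) * (p 1 - q 1)) * h1
  have h4 : (a 0 + b 0 - p 0 - q 0) * (p 0 - q 0) + (a 1 + b 1 - p 1 - q 1) * (p 1 - q 1) = 0 := by
    apply mul_left_cancel₀ h2; linear_combination haq - hap - hbp + hbq
  rcases mul_eq_zero.1 key with h | h
  · left
    have e0 : c * (a 0 - b 0) = 0 := by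
      rw [← hpq]; linear_combination (p 0 - q 0) * h1 - (p 1 - q 1) * h
    have e1 : c * (a 1 - b 1) = 0 := by
      rw [← hpq]; linear_combination (p 1 - q 1) * h1 + (p 0 - q 0) * h
    ext i
    fin_cases i
    · exact (sub_eq_zero.1 ((mul_eq_zero.1 e0).resolve_left hc)).symm
    · exact (sub_eq_zero.1 ((mul_eq_zero.1 e1).resolve_left hc)).symm
  · right
    have e0 : c * (a 0 + b 0 - p 0 - q 0) = 0 := by
      rw [← hpq]; linear_combination (p 0 - q 0) * h4 - (p 1 - q 1) * h
    have e1 : c * (a 1 + b 1 - p 1 - q 1) = 0 := by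
      rw [← hpq]; linear_combination (p 1 - q 1) * h4 + (p 0 - q 0) * h
    replace e0 := (mul_eq_zero.1 e0).resolve_left hc
    replace e1 := (mul_eq_zero.1 e1).resolve_left hc
    ext i
    fin_cases i
    · simp only [Fin.zero_eta, Pi.sub_apply, Pi.add_apply]; linear_combination e0
    · simp only [Fin.mk_one, Pi.sub_apply, Pi.add_apply]; linear_combination e1

/-- The point `x + (c + s i) (p - x)`, in complex notation. -/
noncomputable def spiral (c s : ℝ) (x p : EuclideanSpace ℝ (Fin 2)) : EuclideanSpace ℝ (Fin 2) :=
  !₂[x 0 + c * (p 0 - x 0) - s * (p 1 - x 1), x 1 + s * (p 0 - x 0) + c * (p 1 - x 1)]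

section

variable {F : Type*} [Field F] [Algebra ℝ F] {d : ℝ}

/-- The rhombus made of two equilateral triangles of side `d ∈ D₂(F)` is mapped to a
parallelogram. -/
lemma eventually_map_rhombus (hd : d ∈ D2 F) {x p q : EuclideanSpace ℝ (Fin 2)}
    (hxp : dist x p = d) (hxq : dist x q = d) (hpq : dist p q = d) :
    ∀ᶠ f in unitFilter F, f (p + q - x) = f p + f q - f x := by
  obtain ⟨hd0, hd⟩ := (mem_D2_iff F d).1 hd
  have : CharZero F := charZero_of_injective_algebraMap (algebraMap ℝ F).injective
  set p' := spiral (5 / 6) (√11 / 6) x p with hp'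
  set q' := spiral (5 / 6) (√11 / 6) x q with hq'
  have h11 : √11 ^ 2 = 11 := Real.sq_sqrt (by norm_num)
  have side {u v : EuclideanSpace ℝ (Fin 2)}
      (h : (u 0 - v 0) ^ 2 + (u 1 - v 1) ^ 2 = d ^ 2) := hd u v ((dist_eq_iff_sq_add_sq hd0 u v).2 h)
  rw [dist_eq_iff_sq_add_sq hd0] at hxp hxq hpq
  have f1 := side hpq
  have f2 := side hxp
  have f3 := side hxq
  have f4 := @side (p + q - x) p (by simp; linear_combination hxq)
  have f5 := @side (p + q - x) q (by simp; linear_combination hxp)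
  have g1 := @side p' q' (by
    simp [hp', hq', spiral]
    linear_combination hpq + ((p 0 - q 0) ^ 2 + (p 1 - q 1) ^ 2) / 36 * h11)
  have g2 := @side x p' (by
    simp [hp', spiral]
    linear_combination hxp + ((x 0 - p 0) ^ 2 + (x 1 - p 1) ^ 2) / 36 * h11)
  have g3 := @side x q' (by
    simp [hq', spiral]
    linear_combination hxq + ((x 0 - q 0) ^ 2 + (x 1 - q 1) ^ 2) / 36 * h11)
  have g4 := @side (p' + q' - x) p' (by
    simp [hq', spiral]
    linear_combination hxq + ((x 0 - q 0) ^ 2 + (x 1 - q 1) ^ 2) / 36 * h11)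
  have g5 := @side (p' + q' - x) q' (by
    simp [hp', spiral]
    linear_combination hxp + ((x 0 - p 0) ^ 2 + (x 1 - p 1) ^ 2) / 36 * h11)
  have g6 := @side (p + q - x) (p' + q' - x) (by
    simp [hp', hq', spiral]
    linear_combination (2 * hxp + 2 * hxq - hpq) / 3 +
      ((p 0 + q 0 - 2 * x 0) ^ 2 + (p 1 + q 1 - 2 * x 1) ^ 2) / 36 * h11)
  have hc : algebraMap ℝ F (d ^ 2) ≠ 0 := by
    simpa using hd0.ne'
  filter_upwards [f1, f2, f3, f4, f5, g1, g2, g3, g4, g5, g6]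
    with f f1 f2 f3 f4 f5 g1 g2 g3 g4 g5 g6
  rcases eq_or_eq_of_phi2_eq hc f1 f2 f3 f4 f5 with h | h
  · exfalso
    rw [h] at g6
    rcases eq_or_eq_of_phi2_eq hc g1 g2 g3 g4 g5 with h' | h'
    · rw [h'] at g6
      simp only [phi2, sub_self] at g6
      exact hc (by rw [← g6]; ring)
    · rw [h'] at g6
      simp only [phi2, Pi.add_apply, Pi.sub_apply] at g1 g2 g3 g6
      refine hc (mul_left_cancel₀ (two_ne_zero (α := F)) ?_)
      linear_combination g6 - 2 * g2 - 2 * g3 + g1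
  · exact h

lemma eventually_map_reflect (hd : d ∈ D2 F) {x m : EuclideanSpace ℝ (Fin 2)}
    (hxm : dist x m = d) :
    ∀ᶠ f in unitFilter F, f (m + m - x) = f m + f m - f x := by
  have hd0 : 0 < d := hd.1
  have h3 : √3 ^ 2 = 3 := Real.sq_sqrt (by norm_num)
  set p := spiral (1 / 2) (√3 / 2) x m with hp
  have hxm' := (dist_eq_iff_sq_add_sq hd0 _ _).1 hxm
  have hxp : dist x p = d := by
    rw [dist_eq_iff_sq_add_sq hd0]
    simp [hp, spiral]
    linear_combination hxm' + ((x 0 - m 0) ^ 2 + (x 1 - m 1) ^ 2) / 4 * h3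
  have hmp : dist m p = d := by
    rw [dist_eq_iff_sq_add_sq hd0]
    simp [hp, spiral]
    linear_combination hxm' + ((x 0 - m 0) ^ 2 + (x 1 - m 1) ^ 2) / 4 * h3
  have hpq : dist p (m + p - x) = d := by
    rw [← hxm, dist_comm x m, dist_eq_norm, dist_eq_norm, ← norm_neg]; congr 1; abel
  have hmq : dist m (m + p - x) = d := by
    rw [← hxp, dist_eq_norm, dist_eq_norm]; congr 1; abel
  filter_upwards [eventually_map_rhombus hd hxm hxp hmp,
    eventually_map_rhombus hd ((dist_comm p m).trans hmp) hpq hmq] with f h1 h2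
  rw [h1, show m + (m + p - x) - p = m + m - x by abel] at h2
  rw [h2]
  abel

lemma eventually_map_add_nsmul (hd : d ∈ D2 F) (z : EuclideanSpace ℝ (Fin 2))
    {a : EuclideanSpace ℝ (Fin 2)} (ha : ‖a‖ = d) (n : ℕ) :
    ∀ᶠ f in unitFilter F, f (z + n • a) = f z + n • (f (z + a) - f z) := by
  induction n using Nat.twoStepInduction with
  | zero => simp
  | one => simp
  | more n h1 h2 =>
    have h := eventually_map_reflect hd (x := z + n • a) (m := z + (n + 1) • a) (by
      rw [dist_comm, dist_eq_norm, ← ha]; congr 1; rw [succ_nsmul]; abel)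
    filter_upwards [h1, h2, h] with f h1 h2 h
    rw [h1, h2] at h
    rw [show z + (n + 2) • a = z + (n + 1) • a + (z + (n + 1) • a) - (z + n • a) by
      simp only [add_nsmul, two_nsmul, one_nsmul]; abel, h]
    simp only [add_nsmul, two_nsmul, one_nsmul]
    abel

end

/-- If `d ∈ D₂(F)`, then for every integer `k ≥ 2` the distance `d/k` belongs to
`D₂(F)`. -/
theorem stmt13 (F : Type*) [Field F] [Algebra ℝ F] (d : ℝ) (hd : d ∈ D2 F)
    (k : ℕ) (hk : 2 ≤ k) :
    d / k ∈ D2 F := by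
  have hd0 : 0 < d := hd.1
  have : CharZero F := charZero_of_injective_algebraMap (algebraMap ℝ F).injective
  have hk2 : (2 : ℝ) ≤ k := by exact_mod_cast hk
  have hk0 : (k : ℝ) ≠ 0 := by positivity
  have hkF : (k : F) ≠ 0 := by simp; omega
  have hdk : 0 < d / k := by positivity
  refine (mem_D2_iff F _).2 ⟨hdk, fun x y hxy => ?_⟩
  set h := √((k : ℝ) ^ 2 - 1 / 4)
  have h2 : h ^ 2 = (k : ℝ) ^ 2 - 1 / 4 := Real.sq_sqrt (by nlinarith)
  set z := spiral (1 / 2) h x y with hz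
  have hxy' : ((x 0 - y 0) ^ 2 + (x 1 - y 1) ^ 2) * (k : ℝ) ^ 2 = d ^ 2 := by
    rw [(dist_eq_iff_sq_add_sq hdk _ _).1 hxy]
    field_simp
  have hx : ‖x - z‖ = d := by
    rw [← dist_eq_norm, dist_eq_iff_sq_add_sq hd0]
    simp [hz, spiral]
    linear_combination hxy' + ((x 0 - y 0) ^ 2 + (x 1 - y 1) ^ 2) * h2
  have hy : ‖y - z‖ = d := by
    rw [← dist_eq_norm, dist_eq_iff_sq_add_sq hd0]
    simp [hz, spiral]
    linear_combination hxy' + ((x 0 - y 0) ^ 2 + (x 1 - y 1) ^ 2) * h2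
  have hfar : dist (z + k • (x - z)) (z + k • (y - z)) = d := by
    rw [dist_eq_iff_sq_add_sq hd0]
    simp
    linear_combination hxy'
  filter_upwards [eventually_map_add_nsmul hd z hx k, eventually_map_add_nsmul hd z hy k,
    ((mem_D2_iff F d).1 hd).2 _ _ hfar] with f fx fy ff
  rw [fx, fy] at ff
  simp only [add_sub_cancel, phi2, Pi.add_apply, Pi.mul_apply, Pi.natCast_apply, Pi.sub_apply,
    nsmul_eq_mul] at ff
  rw [div_pow, map_div₀, map_pow _ (k : ℝ), map_natCast, eq_div_iff (pow_ne_zero 2 hkF), ← ff, phi2]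
  ring
end
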